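/- Let φ(x) = (2π)^(−1/2) exp(−x²/2) denote the standard normal density and Φ(x) = ∫_{−∞}^x φ(t) dt the standard normal CDF. Fix σ > 0 and thresholds a < b, and define h(x) = −log( Φ((b − x)/σ) − Φ((a − x)/σ) ). Then for every x ∈ ℝ the derivative of h is bounded by |h'(x)| ≤ max(|a − x|, |b − x|)/σ². (Gradient bound for the per-entry Probit loss.) -/

import Mathlib

open MeasureTheory

/-- The standard normal density `φ(x) = (2π)^(−1/2) exp(−x²/2)`. -/
noncomputable def stdNormalPDF (x : ℝ) : ℝ :=
  (Real.sqrt (2 * Real.pi))⁻¹ * Real.exp (-x ^ 2 / 2)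

/-- The standard normal CDF `Φ(x) = ∫_{−∞}^x φ(t) dt`. -/
noncomputable def stdNormalCDF (x : ℝ) : ℝ :=
  ∫ t in Set.Iic x, stdNormalPDF t

lemma stdNormalPDF_pos (x : ℝ) : 0 < stdNormalPDF x := by
  unfold stdNormalPDF
  positivity

lemma stdNormalPDF_eq_gaussianPDFReal : stdNormalPDF = ProbabilityTheory.gaussianPDFReal 0 1 := by
  ext x
  simp [stdNormalPDF, ProbabilityTheory.gaussianPDFReal]

lemma integrable_stdNormalPDF : Integrable stdNormalPDF :=
  stdNormalPDF_eq_gaussianPDFReal ▸ ProbabilityTheory.integrable_gaussianPDFReal 0 1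

lemma hasDerivAt_stdNormalPDF (x : ℝ) :
    HasDerivAt stdNormalPDF (-x * stdNormalPDF x) x := by
  have h : HasDerivAt (fun y : ℝ => -y ^ 2 / 2) (-x) x :=
    (((hasDerivAt_pow 2 x).neg).div_const 2).congr_deriv (by norm_num; ring)
  exact (h.exp.const_mul (Real.sqrt (2 * Real.pi))⁻¹).congr_deriv (by
    unfold stdNormalPDF
    ring)

lemma continuous_stdNormalPDF : Continuous stdNormalPDF :=
  continuous_iff_continuousAt.2 fun x => (hasDerivAt_stdNormalPDF x).continuousAt

lemma hasDerivAt_stdNormalCDF (x : ℝ) : HasDerivAt stdNormalCDF (stdNormalPDF x) x := by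
  have h : stdNormalCDF = fun y => stdNormalCDF 0 + ∫ t in (0 : ℝ)..y, stdNormalPDF t := by
    ext y
    rw [← intervalIntegral.integral_Iic_sub_Iic integrable_stdNormalPDF.integrableOn
      integrable_stdNormalPDF.integrableOn]
    simp [stdNormalCDF]
  rw [h]
  exact (continuous_stdNormalPDF.integral_hasStrictDerivAt 0 x).hasDerivAt.const_add _

lemma strictMono_stdNormalCDF : StrictMono stdNormalCDF :=
  strictMono_of_hasDerivAt_pos hasDerivAt_stdNormalCDF stdNormalPDF_pos

/-- Cauchy's mean value theorem applied to the standard normal density and CDF. -/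
lemma exists_stdNormalPDF_sub_eq_neg_mul {u v : ℝ} (huv : u < v) :
    ∃ c ∈ Set.Ioo u v,
      stdNormalPDF v - stdNormalPDF u = -c * (stdNormalCDF v - stdNormalCDF u) := by
  obtain ⟨c, hc, h⟩ := exists_ratio_hasDerivAt_eq_ratio_slope stdNormalPDF
    (fun y => -y * stdNormalPDF y) huv continuous_stdNormalPDF.continuousOn
    (fun y _ => hasDerivAt_stdNormalPDF y) stdNormalCDF stdNormalPDF
    (fun y _ => (hasDerivAt_stdNormalCDF y).continuousAt.continuousWithinAt)
    (fun y _ => hasDerivAt_stdNormalCDF y)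
  refine ⟨c, hc, mul_right_cancel₀ (stdNormalPDF_pos c).ne' ?_⟩
  linear_combination -h

/-- Gradient bound for the per-entry Probit loss
`h(x) = −log(Φ((b − x)/σ) − Φ((a − x)/σ))`:
`|h'(x)| ≤ max(|a − x|, |b − x|)/σ²` for every `x`. -/
theorem probit_neg_log_likelihood_deriv_bound (σ a b : ℝ) (hσ : 0 < σ) (hab : a < b) (x : ℝ) :
    |deriv
        (fun x : ℝ => -Real.log (stdNormalCDF ((b - x) / σ) - stdNormalCDF ((a - x) / σ))) x|
      ≤ max |a - x| |b - x| / σ ^ 2 := by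
  have huv : (a - x) / σ < (b - x) / σ := by gcongr
  have hpos := sub_pos.2 (strictMono_stdNormalCDF huv)
  obtain ⟨c, ⟨hac, hcb⟩, hc⟩ := exists_stdNormalPDF_sub_eq_neg_mul huv
  have hcomp (d : ℝ) : HasDerivAt (fun y : ℝ => stdNormalCDF ((d - y) / σ))
      (stdNormalPDF ((d - x) / σ) * (-1 / σ)) x :=
    (hasDerivAt_stdNormalCDF _).comp x (((hasDerivAt_id x).const_sub d).div_const σ)
  have hderiv : HasDerivAt
      (fun y : ℝ => -Real.log (stdNormalCDF ((b - y) / σ) - stdNormalCDF ((a - y) / σ)))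
      (-c / σ) x := by
    refine (((hcomp b).sub (hcomp a)).log hpos.ne').neg.congr_deriv ?_
    rw [← sub_mul, hc, Pi.sub_apply]
    field_simp
  have hcσ : |c| ≤ max |a - x| |b - x| / σ := by
    rw [← abs_of_pos hσ, ← max_div_div_right (abs_nonneg σ), ← abs_div, ← abs_div]
    exact abs_le_max_abs_abs hac.le hcb.le
  rw [hderiv.deriv, abs_div, abs_neg, abs_of_pos hσ, sq, ← div_div]
  gcongr
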